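/- Let A be an ℕ-graded commutative ring, M a ℤ-graded A-module, and f, g homogeneous elements of A of positive degree. Then there is a natural isomorphism of graded modules (M[f⁻¹])[g⁻¹] ≅ M[(fg)⁻¹], where on the left g denotes the image of g in A[f⁻¹]. -/

import Mathlib

section

variable {A : Type*} [CommRing A]

/-- The degree-`n` component of the graded localization `M[a⁻¹]`, where `a` is homogeneous of
degree `da`: it is spanned by fractions `m / aᵏ` with `m` homogeneous of degree `n + k·da`. -/
def locModDeg {M : Type*} [AddCommGroup M] [Module A M]
    (ℳ : ℤ → Submodule ℤ M) (a : A) (da : ℤ) (n : ℤ) :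
    Submodule ℤ (LocalizedModule (Submonoid.powers a) M) :=
  Submodule.span ℤ
    {y | ∃ (k : ℕ) (m : M), m ∈ ℳ (n + (k : ℤ) * da) ∧
      (a ^ k : A) • y = LocalizedModule.mk m 1}

end

/-- powers of `a` act bijectively on a localization at `a`. -/
lemma aux_bij {A M : Type*} [CommRing A] [AddCommGroup M] [Module A M] (a : A) (k : ℕ) :
    Function.Bijective (fun y : LocalizedModule (Submonoid.powers a) M => (a ^ k : A) • y) := by
  have h := IsLocalizedModule.map_units (S := Submonoid.powers a)
    (LocalizedModule.mkLinearMap (Submonoid.powers a) M) ⟨a ^ k, k, rfl⟩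
  exact (Module.End.isUnit_iff _).1 h

/-- if `b` acts bijectively on `M` then it does on any localization. -/
lemma aux_bij2 {A M : Type*} [CommRing A] [AddCommGroup M] [Module A M] (S : Submonoid A) (b : A)
    (h : Function.Bijective (fun y : M => b • y)) :
    Function.Bijective (fun y : LocalizedModule S M => b • y) := by
  constructor
  · intro y z hyz
    induction y using LocalizedModule.induction_on with
    | _ m s =>
    induction z using LocalizedModule.induction_on with
    | _ m' s' =>
      simp only [LocalizedModule.smul'_mk] at hyz
      rw [LocalizedModule.mk_eq] at hyz ⊢
      obtain ⟨u, hu⟩ := hyz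
      refine ⟨u, h.1 ?_⟩
      simp only [Submonoid.smul_def] at hu ⊢
      simpa only [smul_comm _ b] using hu
  · intro y
    induction y using LocalizedModule.induction_on with
    | _ m s =>
      obtain ⟨x, hx⟩ := h.2 m
      refine ⟨LocalizedModule.mk x s, ?_⟩
      simp only at hx ⊢
      rw [LocalizedModule.smul'_mk, hx]

lemma aux_loc {A M : Type*} [CommRing A] [AddCommGroup M] [Module A M] (f g : A) :
    IsLocalizedModule (Submonoid.powers (f * g))
      ((LocalizedModule.mkLinearMap (Submonoid.powers g)
        (LocalizedModule (Submonoid.powers f) M)).comp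
          (LocalizedModule.mkLinearMap (Submonoid.powers f) M)) where
  map_units := by
    rintro ⟨_, k, rfl⟩
    rw [Module.End.isUnit_iff]
    have h := (aux_bij2 (Submonoid.powers g) (f ^ k) (aux_bij (M := M) f k)).comp
      (aux_bij (M := LocalizedModule (Submonoid.powers f) M) g k)
    convert h using 1
    ext y
    change (f * g) ^ k • y = f ^ k • g ^ k • y
    rw [mul_pow, mul_smul]
  surj := by
    intro y
    induction y using LocalizedModule.induction_on with
    | _ w s =>
    induction w using LocalizedModule.induction_on with
    | _ m t =>
      obtain ⟨_, j, rfl⟩ := s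
      obtain ⟨_, k, rfl⟩ := t
      refine ⟨((f ^ j * g ^ k) • m, ⟨(f * g) ^ (j + k), j + k, rfl⟩), ?_⟩
      simp only [Submonoid.smul_def, LinearMap.comp_apply, LocalizedModule.mkLinearMap_apply,
        LocalizedModule.smul'_mk]
      rw [LocalizedModule.mk_eq]
      refine ⟨1, ?_⟩
      simp only [Submonoid.smul_def, one_smul, LocalizedModule.smul'_mk]
      rw [LocalizedModule.mk_eq]
      refine ⟨1, ?_⟩
      simp only [Submonoid.smul_def, one_smul, OneMemClass.coe_one, smul_smul]
      congr 1
      ring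
  exists_of_eq := by
    intro x y h
    simp only [LinearMap.comp_apply, LocalizedModule.mkLinearMap_apply] at h
    rw [LocalizedModule.mk_eq] at h
    obtain ⟨⟨_, j, rfl⟩, h⟩ := h
    simp only [Submonoid.smul_def, one_smul, LocalizedModule.smul'_mk, OneMemClass.coe_one] at h
    rw [LocalizedModule.mk_eq] at h
    obtain ⟨⟨_, k, rfl⟩, h⟩ := h
    simp only [Submonoid.smul_def, one_smul, OneMemClass.coe_one, smul_smul] at h
    refine ⟨⟨(f * g) ^ (j + k), j + k, rfl⟩, ?_⟩
    simp only [Submonoid.smul_def]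
    have e : (f * g) ^ (j + k) = (f ^ j * g ^ k) * (f ^ k * g ^ j) := by ring
    rw [e, mul_smul, h, ← mul_smul]




/-- for an ℕ-graded commutative ring `A`, a ℤ-graded `A`-module `M` and
homogeneous elements `f`, `g` of positive degree, there is an isomorphism of graded modules
`(M[f⁻¹])[g⁻¹] ≅ M[(fg)⁻¹]` compatible with the localization maps from `M` and with the
gradings. -/
theorem stmt13 {A : Type*} [CommRing A] (𝒜 : ℤ → Submodule ℤ A) [GradedAlgebra 𝒜]
    (hA : ∀ n : ℤ, n < 0 → 𝒜 n = ⊥)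
    {M : Type*} [AddCommGroup M] [Module A M]
    (ℳ : ℤ → Submodule ℤ M) [DirectSum.Decomposition ℳ]
    (hℳ : ∀ (i j : ℤ), ∀ c ∈ 𝒜 i, ∀ m ∈ ℳ j, c • m ∈ ℳ (i + j))
    (f g : A) (df dg : ℤ) (hdf : 0 < df) (hdg : 0 < dg)
    (hf : f ∈ 𝒜 df) (hg : g ∈ 𝒜 dg) :
    ∃ e : LocalizedModule (Submonoid.powers g) (LocalizedModule (Submonoid.powers f) M)
            ≃ₗ[A] LocalizedModule (Submonoid.powers (f * g)) M,
      (∀ m : M, e (LocalizedModule.mk (LocalizedModule.mk m 1) 1) = LocalizedModule.mk m 1) ∧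
      (∀ n : ℤ, Submodule.map (e.toLinearMap.restrictScalars ℤ)
          (locModDeg (fun i => locModDeg ℳ f df i) g dg n)
        = locModDeg ℳ (f * g) (df + dg) n) := by
  classical
  have hpow : ∀ (a : A) (d : ℤ), a ∈ 𝒜 d → ∀ k : ℕ, a ^ k ∈ 𝒜 ((k : ℤ) * d) := by
    intro a d ha k
    have := SetLike.pow_mem_graded (A := 𝒜) k ha
    simpa using this
  haveI := aux_loc (M := M) f g
  set ι := ((LocalizedModule.mkLinearMap (Submonoid.powers g)
        (LocalizedModule (Submonoid.powers f) M)).comp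
          (LocalizedModule.mkLinearMap (Submonoid.powers f) M)) with hι
  let e := (IsLocalizedModule.iso (Submonoid.powers (f * g)) ι).symm
  have he : ∀ m : M, e (LocalizedModule.mk (LocalizedModule.mk m 1) 1)
      = LocalizedModule.mk m 1 := by
    intro m
    exact IsLocalizedModule.iso_symm_apply' (Submonoid.powers (f * g)) ι _ _ _
      (by simp [hι])
  refine ⟨e, he, fun n => le_antisymm ?_ ?_⟩
  · rw [Submodule.map_le_iff_le_comap]
    refine Submodule.span_le.2 ?_
    rintro y ⟨k, w, hw, hy⟩
    let φ : LocalizedModule (Submonoid.powers f) M →ₗ[A]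
        LocalizedModule (Submonoid.powers (f * g)) M :=
      e.toLinearMap.comp ((LinearEquiv.ofBijective
        (LinearMap.lsmul A (LocalizedModule (Submonoid.powers g)
          (LocalizedModule (Submonoid.powers f) M)) (g ^ k)) (aux_bij g k)).symm.toLinearMap.comp
        (LocalizedModule.mkLinearMap (Submonoid.powers g) _))
    have hφ : ∀ w, g ^ k • φ w = e (LocalizedModule.mk w 1) := by
      intro w
      simp only [φ, LinearMap.comp_apply, LinearEquiv.coe_coe]
      rw [← map_smul]
      congr 1
      exact (LinearEquiv.ofBijective
        (LinearMap.lsmul A (LocalizedModule (Submonoid.powers g)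
          (LocalizedModule (Submonoid.powers f) M)) (g ^ k)) (aux_bij g k)).apply_symm_apply _
    have hyφ : e y = φ w := by
      have h1 : g ^ k • e.symm (φ w) = g ^ k • y := by
        rw [hy, ← map_smul, hφ, e.symm_apply_apply]
      have h2 := (aux_bij (M := LocalizedModule (Submonoid.powers f) M) g k).1 h1
      rw [← h2, e.apply_symm_apply]
    change e y ∈ locModDeg ℳ (f * g) (df + dg) n
    rw [hyφ]
    have key : locModDeg ℳ f df (n + k * dg) ≤
        (locModDeg ℳ (f * g) (df + dg) n).comap (φ.restrictScalars ℤ) := by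
      refine Submodule.span_le.2 ?_
      rintro w ⟨j, m, hm, hjw⟩
      refine Submodule.subset_span ⟨j + k, (f ^ k * g ^ j) • m, ?_, ?_⟩
      · have h1 := hℳ _ _ _ (SetLike.mul_mem_graded (hpow f df hf k) (hpow g dg hg j)) m hm
        convert h1 using 2
        push_cast
        ring
      · have e1 : (f * g) ^ (j + k) = (f ^ k * g ^ j) * (f ^ j * g ^ k) := by ring
        change (f * g) ^ (j + k) • φ w = _
        rw [e1, mul_smul, mul_smul (f ^ j), hφ, ← map_smul, LocalizedModule.smul'_mk, hjw, he,
          LocalizedModule.smul'_mk]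
    exact key hw
  · refine Submodule.span_le.2 ?_
    rintro z ⟨k, m, hm, hz⟩
    refine ⟨e.symm z, Submodule.subset_span ⟨k, LocalizedModule.mk m ⟨f ^ k, k, rfl⟩, ?_, ?_⟩,
      e.apply_symm_apply z⟩
    · refine Submodule.subset_span ⟨k, m, ?_, ?_⟩
      · convert hm using 2
        ring
      · rw [LocalizedModule.smul'_mk, LocalizedModule.mk_eq]
        exact ⟨1, by simp [Submonoid.smul_def]⟩
    · refine (aux_bij2 (Submonoid.powers g) (f ^ k) (aux_bij (M := M) f k)).1 ?_
      apply e.injective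
      simp only
      rw [← mul_smul, ← mul_pow, map_smul, e.apply_symm_apply, hz, LocalizedModule.smul'_mk,
        ← he m]
      congr 2
      rw [LocalizedModule.smul'_mk, LocalizedModule.mk_eq]
      exact ⟨1, by simp [Submonoid.smul_def]⟩
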